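/- arXiv:2106.09830 — 5 statements merged into one kernel-verified Lean document; each statement's English description precedes it below -/
import Mathlib

section
/- Let F be a field, n a positive integer, and M an invertible n×n matrix over F. Then rank(M − Z₀ M Z₀ᵀ) = rank(M⁻¹ − Z₀ᵀ M⁻¹ Z₀), and likewise rank(M − Z₀ᵀ M Z₀) = rank(M⁻¹ − Z₀ M⁻¹ Z₀ᵀ). In other words, the (+)-displacement rank of M equals the (−)-displacement rank of M⁻¹, and vice versa. -/
open Matrix

/-- The `n × n` lower shift matrix: ones on the subdiagonal, zeros elsewhere. -/
def Z0 (n : ℕ) (F : Type*) [Semiring F] : Matrix (Fin n) (Fin n) F :=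
  Matrix.of fun i j => if (i : ℕ) = (j : ℕ) + 1 then 1 else 0

theorem disp_aux {F : Type*} [Field F] {n : ℕ} (M N P Q : Matrix (Fin n) (Fin n) F)
    (h : N * M = 1) : (N - Q * N * P).rank ≤ (M - P * M * Q).rank := by
  have key : ∀ x, (M - P * M * Q).mulVecLin x = 0 → M *ᵥ x = P *ᵥ (M *ᵥ (Q *ᵥ x)) := by
    intro x hx
    simpa [Matrix.sub_mulVec, sub_eq_zero, Matrix.mulVec_mulVec, Matrix.mul_assoc] using hx
  have hinj : ∀ v, N *ᵥ (M *ᵥ v) = v := by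
    intro v
    rw [Matrix.mulVec_mulVec, h, Matrix.one_mulVec]
  have hmem : ∀ x ∈ LinearMap.ker (M - P * M * Q).mulVecLin,
      (M * Q).mulVecLin x ∈ LinearMap.ker (N - Q * N * P).mulVecLin := by
    intro x hx
    have h1 := key x (LinearMap.mem_ker.1 hx)
    rw [LinearMap.mem_ker, Matrix.mulVecLin_apply, Matrix.mulVecLin_apply, Matrix.sub_mulVec,
      ← Matrix.mulVec_mulVec, hinj, ← Matrix.mulVec_mulVec, ← Matrix.mulVec_mulVec, ← h1, hinj,
      sub_self]
  have hle := LinearMap.finrank_le_finrank_of_injective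
    (f := (M * Q).mulVecLin.restrict hmem) (by
      rw [← LinearMap.ker_eq_bot, LinearMap.ker_eq_bot']
      rintro ⟨x, hx⟩ h0
      have h0' : M *ᵥ (Q *ᵥ x) = 0 := by
        have := congrArg Subtype.val h0
        rw [Matrix.mulVec_mulVec]
        exact this
      have h1 := key x (LinearMap.mem_ker.1 hx)
      rw [h0', Matrix.mulVec_zero] at h1
      have h2 := hinj x
      rw [h1, Matrix.mulVec_zero] at h2
      exact Subtype.ext h2.symm)
  have e1 := LinearMap.finrank_range_add_finrank_ker (M - P * M * Q).mulVecLin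
  have e2 := LinearMap.finrank_range_add_finrank_ker (N - Q * N * P).mulVecLin
  unfold Matrix.rank
  omega

theorem disp_aux2 {F : Type*} [Field F] {n : ℕ} (M P Q : Matrix (Fin n) (Fin n) F)
    (hM : IsUnit M) : (M - P * M * Q).rank = (M⁻¹ - Q * M⁻¹ * P).rank := by
  have hd := (Matrix.isUnit_iff_isUnit_det M).1 hM
  exact le_antisymm (disp_aux _ _ _ _ (Matrix.mul_nonsing_inv M hd))
    (disp_aux _ _ _ _ (Matrix.nonsing_inv_mul M hd))

/-- The (+)-displacement rank of an invertible matrix equals the (−)-displacement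
rank of its inverse, and vice versa. -/
theorem displacement_rank_of_inverse (F : Type*) [Field F] (n : ℕ) (hn : 0 < n)
    (M : Matrix (Fin n) (Fin n) F) (hM : IsUnit M) :
    (M - Z0 n F * M * (Z0 n F)ᵀ).rank = (M⁻¹ - (Z0 n F)ᵀ * M⁻¹ * Z0 n F).rank ∧
    (M - (Z0 n F)ᵀ * M * Z0 n F).rank = (M⁻¹ - Z0 n F * M⁻¹ * (Z0 n F)ᵀ).rank := by
  exact ⟨disp_aux2 M _ _ hM, disp_aux2 M _ _ hM⟩
end

section
/- Let F be a field, n and α positive integers, and x_i, y_i ∈ Fⁿ column vectors for 1 ≤ i ≤ α. Then the matrix equation A − Z₀ A Z₀ᵀ = Σ_{i=1}^{α} x_i y_iᵀ has the unique solution A = Σ_{i=1}^{α} L(x_i) U(y_i), where U(y_i) = L(y_i)ᵀ. -/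
open Matrix

/-- `L w` is the lower-triangular Toeplitz matrix whose first column is `w`. -/
def L {F : Type*} [Semiring F] {n : ℕ} (w : Fin n → F) : Matrix (Fin n) (Fin n) F :=
  Matrix.of fun j k =>
    if (k : ℕ) ≤ (j : ℕ) then
      w ⟨(j : ℕ) - (k : ℕ), Nat.lt_of_le_of_lt (Nat.sub_le _ _) j.isLt⟩
    else 0

theorem Z0_conj_apply {F : Type*} [Field F] {m : ℕ} (A : Matrix (Fin (m+1)) (Fin (m+1)) F) :
    (∀ j, (Z0 (m+1) F * A * (Z0 (m+1) F)ᵀ) 0 j = 0) ∧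
    (∀ i, (Z0 (m+1) F * A * (Z0 (m+1) F)ᵀ) i 0 = 0) ∧
    (∀ i j : Fin m, (Z0 (m+1) F * A * (Z0 (m+1) F)ᵀ) i.succ j.succ
      = A i.castSucc j.castSucc) := by
  have h0 : ∀ k, Z0 (m+1) F 0 k = 0 := by intro k; simp [Z0]
  have hs : ∀ (i : Fin m) k, Z0 (m+1) F i.succ k = if k = i.castSucc then 1 else 0 := by
    intro i k
    simp only [Z0, Matrix.of_apply, Fin.ext_iff, Fin.val_succ, Fin.val_castSucc]
    congr 1
    apply propext
    omega
  refine ⟨fun j => ?_, fun i => ?_, fun i j => ?_⟩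
  · simp [Matrix.mul_apply, h0]
  · simp [Matrix.mul_apply, h0]
  · simp [Matrix.mul_apply, hs]

theorem LU_displacement {F : Type*} [Field F] {m : ℕ} (x y : Fin (m+1) → F) :
    L x * (L y)ᵀ - Z0 (m+1) F * (L x * (L y)ᵀ) * (Z0 (m+1) F)ᵀ = vecMulVec x y := by
  have hc : ∀ (w : Fin (m+1) → F) i, L w i 0 = w i := by intro w i; simp [L]
  have hz : ∀ (w : Fin (m+1) → F) (k : Fin m), L w 0 k.succ = 0 := by intro w i; simp [L]
  have hs : ∀ (w : Fin (m+1) → F) (i k : Fin m),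
      L w i.succ k.succ = L w i.castSucc k.castSucc := by intro w i k; simp [L]
  have hl : ∀ (w : Fin (m+1) → F) (i : Fin m), L w i.castSucc (Fin.last m) = 0 := by
    intro w i; simp [L]
  obtain ⟨h1, h2, h3⟩ := Z0_conj_apply (L x * (L y)ᵀ)
  ext i j
  rw [Matrix.sub_apply, vecMulVec_apply]
  refine Fin.cases ?_ (fun i => ?_) i
  · rw [h1, Matrix.mul_apply, Fin.sum_univ_succ]
    simp [hc, hz]
  · refine Fin.cases ?_ (fun j => ?_) j
    · rw [h2, Matrix.mul_apply, Fin.sum_univ_succ]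
      simp [hc, hz]
    · rw [h3, Matrix.mul_apply, Fin.sum_univ_succ, Matrix.mul_apply, Fin.sum_univ_castSucc]
      simp [hc, hs, hl]

theorem displacement_inj {F : Type*} [Field F] {m : ℕ} (D : Matrix (Fin (m+1)) (Fin (m+1)) F)
    (h : D = Z0 (m+1) F * D * (Z0 (m+1) F)ᵀ) : D = 0 := by
  obtain ⟨h1, h2, h3⟩ := Z0_conj_apply D
  rw [← h] at h1 h2 h3
  have key : ∀ i j, D i j = 0 := by
    intro i
    induction i using Fin.induction with
    | zero => exact h1
    | succ i ih =>
      intro j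
      refine Fin.cases (h2 _) (fun j => ?_) j
      rw [h3, ih]
  ext i j
  exact key i j

/-- The equation `A - Z₀ A Z₀ᵀ = ∑ᵢ xᵢ yᵢᵀ` has the unique solution
`A = ∑ᵢ L(xᵢ) U(yᵢ)` with `U(yᵢ) = L(yᵢ)ᵀ`. -/
theorem toeplitz_displacement_generator_solution (F : Type*) [Field F] (n α : ℕ)
    (hn : 0 < n) (hα : 0 < α) (x y : Fin α → Fin n → F)
    (A : Matrix (Fin n) (Fin n) F) :
    A - Z0 n F * A * (Z0 n F)ᵀ = ∑ i, vecMulVec (x i) (y i) ↔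
      A = ∑ i, L (x i) * (L (y i))ᵀ := by
  obtain ⟨m, rfl⟩ : ∃ m, n = m + 1 := ⟨n - 1, by omega⟩
  have hB : (∑ i, L (x i) * (L (y i))ᵀ)
      - Z0 (m+1) F * (∑ i, L (x i) * (L (y i))ᵀ) * (Z0 (m+1) F)ᵀ
      = ∑ i, vecMulVec (x i) (y i) := by
    rw [Finset.mul_sum, Finset.sum_mul, ← Finset.sum_sub_distrib]
    exact Finset.sum_congr rfl fun i _ => LU_displacement (x i) (y i)
  constructor
  · intro h
    rw [← hB] at h
    rw [← sub_eq_zero]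
    apply displacement_inj
    rw [mul_sub, sub_mul]
    rw [sub_eq_sub_iff_sub_eq_sub] at h
    exact h
  · rintro rfl
    exact hB
end

section
/- Let F be a field, n a positive integer, and T an invertible n×n Toeplitz matrix over F (i.e., T_{j,k} = t_{j−k} for some scalars t_{−(n−1)},…,t_{n−1}). Then rank(T⁻¹ − Z₀ᵀ T⁻¹ Z₀) ≤ 2, i.e., the inverse of a Toeplitz matrix has (−)-displacement rank at most 2. -/
open Matrix

theorem ker_le_aux {F : Type*} [Field F] {n : ℕ} (A B : Matrix (Fin n) (Fin n) F) :
    Module.finrank F (LinearMap.ker (1 - B * A).mulVecLin) ≤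
      Module.finrank F (LinearMap.ker (1 - A * B).mulVecLin) := by
  have key : ∀ x ∈ LinearMap.ker (1 - B * A).mulVecLin, B *ᵥ (A *ᵥ x) = x := by
    intro x hx
    rw [LinearMap.mem_ker, mulVecLin_apply, sub_mulVec, one_mulVec, sub_eq_zero] at hx
    rw [mulVec_mulVec]; exact hx.symm
  have hm : ∀ x ∈ LinearMap.ker (1 - B * A).mulVecLin,
      A.mulVecLin x ∈ LinearMap.ker (1 - A * B).mulVecLin := by
    intro x hx
    rw [LinearMap.mem_ker, mulVecLin_apply, mulVecLin_apply, sub_mulVec, one_mulVec, sub_eq_zero,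
      ← mulVec_mulVec, key x hx]
  refine LinearMap.finrank_le_finrank_of_injective (f := A.mulVecLin.restrict hm) ?_
  intro x y h
  have h2 : A *ᵥ x.1 = A *ᵥ y.1 := congrArg Subtype.val h
  apply Subtype.ext
  rw [← key x.1 x.2, ← key y.1 y.2, h2]

theorem rank_le_aux {F : Type*} [Field F] {n : ℕ} (A B : Matrix (Fin n) (Fin n) F) :
    (1 - A * B).rank ≤ (1 - B * A).rank := by
  have h1 := LinearMap.finrank_range_add_finrank_ker (1 - A * B).mulVecLin
  have h2 := LinearMap.finrank_range_add_finrank_ker (1 - B * A).mulVecLin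
  have h3 := ker_le_aux A B
  unfold Matrix.rank
  omega

theorem Z0_mul_zero {F : Type*} [Field F] {m : ℕ} (M : Matrix (Fin (m+1)) (Fin (m+1)) F) (k) :
    (Z0 (m+1) F * M) 0 k = 0 := by
  simp [Matrix.mul_apply, Z0]

theorem Z0_mul_succ {F : Type*} [Field F] {m : ℕ} (M : Matrix (Fin (m+1)) (Fin (m+1)) F)
    (i : Fin m) (k) : (Z0 (m+1) F * M) i.succ k = M i.castSucc k := by
  rw [Matrix.mul_apply, Finset.sum_eq_single i.castSucc]
  · simp [Z0]
  · intro b _ hb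
    have : ¬ ((i : ℕ) = b) := fun h => hb (Fin.ext h.symm)
    simp [Z0, this]
  · simp

theorem rank_add_aux {F : Type*} [Field F] {n : ℕ} (A B : Matrix (Fin n) (Fin n) F) :
    (A + B).rank ≤ A.rank + B.rank := by
  unfold Matrix.rank
  refine le_trans (Submodule.finrank_mono ?_)
    (Submodule.finrank_add_le_finrank_add_finrank A.mulVecLin.range B.mulVecLin.range)
  rintro _ ⟨x, rfl⟩
  rw [mulVecLin_apply, add_mulVec]
  exact Submodule.add_mem_sup ⟨x, rfl⟩ ⟨x, rfl⟩

theorem disp_aux_s10 {F : Type*} [Field F] {m : ℕ} (T : Matrix (Fin (m+1)) (Fin (m+1)) F)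
    (t : ℤ → F) (hTt : ∀ j k : Fin (m+1), T j k = t (((j : ℕ) : ℤ) - ((k : ℕ) : ℤ))) :
    (T - Z0 (m+1) F * T * (Z0 (m+1) F)ᵀ).rank ≤ 2 := by
  have h : T - Z0 (m+1) F * T * (Z0 (m+1) F)ᵀ =
      vecMulVec (Pi.single 0 1) (T 0) +
        vecMulVec (fun i => if i = 0 then 0 else T i 0) (Pi.single 0 1) := by
    have e : Z0 (m+1) F * T * (Z0 (m+1) F)ᵀ = (Z0 (m+1) F * (Z0 (m+1) F * T)ᵀ)ᵀ := by
      simp [Matrix.transpose_mul, Matrix.mul_assoc]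
    rw [e]
    ext i k
    rw [Matrix.sub_apply, transpose_apply, Matrix.add_apply, vecMulVec_apply, vecMulVec_apply]
    refine Fin.cases ?_ (fun k => ?_) k
    · rw [Z0_mul_zero]
      refine Fin.cases ?_ (fun i => ?_) i <;> simp
    · rw [Z0_mul_succ, transpose_apply]
      refine Fin.cases ?_ (fun i => ?_) i
      · rw [Z0_mul_zero]; simp
      · rw [Z0_mul_succ, hTt, hTt]; simp
  rw [h]
  refine (rank_add_aux _ _).trans ?_
  exact add_le_add (rank_vecMulVec_le _ _) (rank_vecMulVec_le _ _)

/-- The inverse of an invertible Toeplitz matrix has (−)-displacement rank at most 2. -/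
theorem toeplitz_inverse_displacement_rank_le_two (F : Type*) [Field F] (n : ℕ)
    (hn : 0 < n) (T : Matrix (Fin n) (Fin n) F) (hT : IsUnit T) (t : ℤ → F)
    (hTt : ∀ j k : Fin n, T j k = t (((j : ℕ) : ℤ) - ((k : ℕ) : ℤ))) :
    (T⁻¹ - (Z0 n F)ᵀ * T⁻¹ * Z0 n F).rank ≤ 2 := by
  obtain ⟨m, rfl⟩ : ∃ m, n = m + 1 := ⟨n - 1, by omega⟩
  have hd : IsUnit T.det := (Matrix.isUnit_iff_isUnit_det T).1 hT
  have hl : T⁻¹ * T = 1 := nonsing_inv_mul T hd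
  have hr : T * T⁻¹ = 1 := mul_nonsing_inv T hd
  have e1 : T⁻¹ - (Z0 (m+1) F)ᵀ * T⁻¹ * Z0 (m+1) F =
      T⁻¹ * (1 - (T * (Z0 (m+1) F)ᵀ) * (T⁻¹ * Z0 (m+1) F)) := by
    rw [mul_sub, mul_one, mul_assoc T, ← mul_assoc T⁻¹ T, hl, one_mul, mul_assoc]
  have e2 : 1 - (T⁻¹ * Z0 (m+1) F) * (T * (Z0 (m+1) F)ᵀ) =
      T⁻¹ * (T - Z0 (m+1) F * T * (Z0 (m+1) F)ᵀ) := by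
    rw [mul_sub, hl]; simp only [mul_assoc]
  rw [e1]
  refine (rank_mul_le_right _ _).trans ((rank_le_aux _ _).trans ?_)
  rw [e2]
  exact (rank_mul_le_right _ _).trans (disp_aux_s10 T t hTt)
end

section
/- Let F be a field, n and α positive integers, u ∈ Fⁿ, and x_i, y_i ∈ Fⁿ column vectors for 1 ≤ i ≤ α. Then the matrix equation A − D(u) A Z₀ᵀ = Σ_{i=1}^{α} x_i y_iᵀ has the unique solution A = Σ_{i=1}^{α} D(x_i) V(u) L(y_i)ᵀ. -/
open Matrix

/-- The `n × n` Vandermonde matrix with nodes `u`: entries `u i ^ j` (0-based). -/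
def Vand {F : Type*} [Semiring F] {n : ℕ} (u : Fin n → F) : Matrix (Fin n) (Fin n) F :=
  Matrix.of fun i j => u i ^ (j : ℕ)

theorem shift_apply {F : Type*} [Field F] {n : ℕ} (u : Fin n → F)
    (A : Matrix (Fin n) (Fin n) F) (i : Fin n) (j : ℕ) (hj : j + 1 < n) :
    (Matrix.diagonal u * A * (Z0 n F)ᵀ) i ⟨j + 1, hj⟩ = u i * A i ⟨j, by omega⟩ := by
  rw [Matrix.mul_apply, Finset.sum_eq_single (⟨j, by omega⟩ : Fin n)]
  · simp [Z0, Matrix.diagonal_mul]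
  · intro b _ hb
    have : ¬ (j = (b : ℕ)) := fun h => hb (Fin.ext h.symm)
    simp [Z0, this]
  · simp

theorem shift_zero {F : Type*} [Field F] {n : ℕ} (u : Fin n → F)
    (A : Matrix (Fin n) (Fin n) F) (i : Fin n) (hj : 0 < n) :
    (Matrix.diagonal u * A * (Z0 n F)ᵀ) i ⟨0, hj⟩ = 0 := by
  rw [Matrix.mul_apply]
  apply Finset.sum_eq_zero
  intro b _
  simp [Z0]

theorem sol_apply {F : Type*} [Field F] {n : ℕ} (u x y : Fin n → F) (i : Fin n) (j : ℕ)
    (hj : j < n) :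
    (Matrix.diagonal x * Vand u * (L y)ᵀ) i ⟨j, hj⟩ =
      x i * ∑ k ∈ Finset.range (j + 1),
        u i ^ k * (if h : j - k < n then y ⟨j - k, h⟩ else 0) := by
  have h1 : (Matrix.diagonal x * Vand u * (L y)ᵀ) i ⟨j, hj⟩ =
      x i * ∑ k : Fin n, (fun k : ℕ => if k ≤ j then
        u i ^ k * (if h : j - k < n then y ⟨j - k, h⟩ else 0) else 0) (k : ℕ) := by
    rw [Matrix.mul_apply, Finset.mul_sum]
    apply Finset.sum_congr rfl
    intro k _
    have hk : j - (k : ℕ) < n := by omega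
    by_cases h : (k : ℕ) ≤ j <;> simp [Matrix.diagonal_mul, Vand, L, h, hk, mul_assoc, -Fin.val_fin_le, Fin.le_def, Fin.lt_def] <;>
      intros <;> omega
  rw [h1]
  congr 1
  refine (Fin.sum_univ_eq_sum_range (fun k : ℕ => if k ≤ j then
        u i ^ k * (if h : j - k < n then y ⟨j - k, h⟩ else 0) else 0) n).trans ?_
  rw [← Finset.sum_filter]
  apply Finset.sum_congr _ (fun _ _ => rfl)
  ext k
  simp only [Finset.mem_filter, Finset.mem_range]
  omega

theorem sol_eq {F : Type*} [Field F] {n : ℕ} (u x y : Fin n → F) :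
    Matrix.diagonal x * Vand u * (L y)ᵀ
      - Matrix.diagonal u * (Matrix.diagonal x * Vand u * (L y)ᵀ) * (Z0 n F)ᵀ
      = vecMulVec x y := by
  ext i ⟨j, hj⟩
  rw [Matrix.sub_apply, vecMulVec_apply]
  cases j with
  | zero => rw [shift_zero, sol_apply]; simp [hj]
  | succ j =>
    rw [shift_apply, sol_apply, sol_apply, Finset.sum_range_succ']
    have : ∑ k ∈ Finset.range (j + 1),
        u i ^ (k + 1) * (if h : j + 1 - (k + 1) < n then y ⟨j + 1 - (k + 1), h⟩ else 0)
        = u i * ∑ k ∈ Finset.range (j + 1),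
        u i ^ k * (if h : j - k < n then y ⟨j - k, h⟩ else 0) := by
      rw [Finset.mul_sum]
      apply Finset.sum_congr rfl
      intro k _
      simp only [Nat.add_sub_add_right]
      ring
    rw [this]
    simp only [Nat.sub_zero, hj, dif_pos, pow_zero]
    ring

theorem disp_inj {F : Type*} [Field F] {n : ℕ} (u : Fin n → F)
    (A B : Matrix (Fin n) (Fin n) F)
    (h : A - Matrix.diagonal u * A * (Z0 n F)ᵀ = B - Matrix.diagonal u * B * (Z0 n F)ᵀ) :
    A = B := by
  ext i ⟨j, hj⟩
  induction j with
  | zero =>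
    have := congrFun (congrFun h i) ⟨0, hj⟩
    rw [Matrix.sub_apply, Matrix.sub_apply, shift_zero, shift_zero] at this
    simpa using this
  | succ j ih =>
    have := congrFun (congrFun h i) ⟨j + 1, hj⟩
    rw [Matrix.sub_apply, Matrix.sub_apply, shift_apply, shift_apply, ih] at this
    exact sub_left_injective this

/-- The equation `A - D(u) A Z₀ᵀ = ∑ᵢ xᵢ yᵢᵀ` has the unique solution
`A = ∑ᵢ D(xᵢ) V(u) L(yᵢ)ᵀ`. -/
theorem vandermonde_displacement_generator_solution (F : Type*) [Field F] (n α : ℕ)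
    (hn : 0 < n) (hα : 0 < α) (u : Fin n → F) (x y : Fin α → Fin n → F)
    (A : Matrix (Fin n) (Fin n) F) :
    A - Matrix.diagonal u * A * (Z0 n F)ᵀ = ∑ i, vecMulVec (x i) (y i) ↔
      A = ∑ i, Matrix.diagonal (x i) * Vand u * (L (y i))ᵀ := by
  have key : (∑ i, Matrix.diagonal (x i) * Vand u * (L (y i))ᵀ)
      - Matrix.diagonal u * (∑ i, Matrix.diagonal (x i) * Vand u * (L (y i))ᵀ) * (Z0 n F)ᵀ
      = ∑ i, vecMulVec (x i) (y i) := by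
    rw [Finset.mul_sum, Finset.sum_mul, ← Finset.sum_sub_distrib]
    exact Finset.sum_congr rfl fun i _ => sol_eq u (x i) (y i)
  constructor
  · intro h
    exact disp_inj u _ _ (h.trans key.symm)
  · rintro rfl
    exact key
end

section
/- Let F be a field, m and α positive integers, u₁,…,u_m, v₁,…,v_m ∈ F with u_i ≠ v_j for all 1 ≤ i, j ≤ m, and x_i, y_i ∈ Fᵐ column vectors for 1 ≤ i ≤ α. If A is an m×m matrix over F satisfying D(u) A − A D(v) = Σ_{i=1}^{α} x_i y_iᵀ, then A = Σ_{i=1}^{α} D(x_i) C(u,v) D(y_i), where C(u,v) is the Cauchy matrix with entries C(u,v)_{i,j} = (u_i − v_j)⁻¹. -/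
open Matrix

/-- If `D(u) A - A D(v) = ∑ᵢ xᵢ yᵢᵀ` with `u i ≠ v j` for all `i, j`, then
`A = ∑ᵢ D(xᵢ) C(u,v) D(yᵢ)` where `C(u,v)` is the Cauchy matrix. -/
theorem cauchy_displacement_generator_solution (F : Type*) [Field F] (m α : ℕ)
    (hm : 0 < m) (hα : 0 < α) (u v : Fin m → F) (huv : ∀ i j : Fin m, u i ≠ v j)
    (x y : Fin α → Fin m → F) (A : Matrix (Fin m) (Fin m) F)
    (hA : Matrix.diagonal u * A - A * Matrix.diagonal v = ∑ i, vecMulVec (x i) (y i)) :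
    A = ∑ i, Matrix.diagonal (x i) *
          Matrix.of (fun a b : Fin m => (u a - v b)⁻¹) * Matrix.diagonal (y i) := by
  ext a b
  have h := congrFun (congrFun hA a) b
  simp only [Matrix.sub_apply, Matrix.diagonal_mul, Matrix.mul_diagonal, Matrix.sum_apply,
    vecMulVec_apply] at h
  simp only [Matrix.sum_apply, Matrix.diagonal_mul, Matrix.mul_diagonal, Matrix.of_apply]
  have hne : u a - v b ≠ 0 := sub_ne_zero.mpr (huv a b)
  have h2 : ∑ i, x i a * (u a - v b)⁻¹ * y i b = (u a - v b)⁻¹ * ∑ i, x i a * y i b := by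
    rw [Finset.mul_sum]
    exact Finset.sum_congr rfl fun i _ => by ring
  rw [h2, ← h]
  field_simp
end
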